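/- arXiv:2402.11205 — 2 statements merged into one kernel-verified Lean document; each statement's English description precedes it below -/
import Mathlib

section
/- For all p q : Fin n with p ≠ q and every occupation string b : Fin n → Bool with b q = true and b p = false, if the number of occupied sites strictly between p and q, card {k | min p q < k ∧ k < max p q ∧ b k = true}, is even, then a†_p (a_q |b⟩) = |SWAP(b, p, q)⟩, where SWAP(b, p, q) is the occupation string obtained from b by exchanging its p-th and q-th bits. -/
/-- The fermionic Fock space on `n` modes: the free `ℂ`-module on occupation strings. -/
abbrev FockSpace (n : ℕ) : Type := (Fin n → Bool) →₀ ℂ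

/-- The basis vector `|b⟩` indexed by the occupation string `b`. -/
noncomputable def fket {n : ℕ} (b : Fin n → Bool) : FockSpace n := Finsupp.single b 1

/-- The annihilation operator `a_q` in the Jordan–Wigner representation:
`a_q |b⟩ = 0` if `b q = false`, and
`a_q |b⟩ = (-1)^(card {k | k < q ∧ b k = true}) • |update b q false⟩` if `b q = true`. -/
noncomputable def ann (n : ℕ) (q : Fin n) : FockSpace n →ₗ[ℂ] FockSpace n :=
  Finsupp.lsum ℂ fun b =>
    if b q = true then
      ((-1 : ℂ) ^ (Finset.univ.filter fun k => k < q ∧ b k = true).card) •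
        Finsupp.lsingle (Function.update b q false)
    else 0

/-- The creation operator `a†_p` in the Jordan–Wigner representation:
`a†_p |b⟩ = 0` if `b p = true`, and
`a†_p |b⟩ = (-1)^(card {k | k < p ∧ b k = true}) • |update b p true⟩` if `b p = false`. -/
noncomputable def cre (n : ℕ) (p : Fin n) : FockSpace n →ₗ[ℂ] FockSpace n :=
  Finsupp.lsum ℂ fun b =>
    if b p = true then 0
    else
      ((-1 : ℂ) ^ (Finset.univ.filter fun k => k < p ∧ b k = true).card) •
        Finsupp.lsingle (Function.update b p true)

/-- The occupation string obtained from `b` by exchanging its `p`-th and `q`-th bits. -/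
def swapBits {n : ℕ} (b : Fin n → Bool) (p q : Fin n) : Fin n → Bool :=
  Function.update (Function.update b p (b q)) q (b p)

theorem ann_fket {n : ℕ} {q : Fin n} {b : Fin n → Bool} (hq : b q = true) :
    ann n q (fket b) = ((-1 : ℂ) ^ (Finset.univ.filter fun k => k < q ∧ b k = true).card) •
      fket (Function.update b q false) := by
  simp [ann, fket, hq]

theorem cre_fket {n : ℕ} {p : Fin n} {b : Fin n → Bool} (hp : b p = false) :
    cre n p (fket b) = ((-1 : ℂ) ^ (Finset.univ.filter fun k => k < p ∧ b k = true).card) •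
      fket (Function.update b p true) := by
  simp [cre, fket, hp]

/-- The occupied sites below `y` split at an empty site `x < y`. -/
theorem card_occupied_lt_eq_add {n : ℕ} {x y : Fin n} (hxy : x < y) {c : Fin n → Bool}
    (hx : c x = false) :
    (Finset.univ.filter fun k => k < y ∧ c k = true).card =
      (Finset.univ.filter fun k => k < x ∧ c k = true).card +
        (Finset.univ.filter fun k => x < k ∧ k < y ∧ c k = true).card := by
  rw [← Finset.card_union_of_disjoint]
  · congr 1
    ext k
    rcases lt_trichotomy k x with h | rfl | h
    · simp [h, h.trans hxy, h.not_gt]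
    · simp [hx]
    · simp [h, h.not_gt]
  · rw [Finset.disjoint_filter]
    exact fun k _ h h' => h.1.not_gt h'.1

/-- The Jordan–Wigner signs of `a_q` on `b` and of `a†_p` on the resulting string cancel when the
number of occupied sites strictly between `p` and `q` is even. -/
theorem even_jordanWigner_exponent {n : ℕ} {p q : Fin n} (hpq : p ≠ q) {b : Fin n → Bool}
    (hp : b p = false)
    (heven : Even (Finset.univ.filter
        fun k => min p q < k ∧ k < max p q ∧ b k = true).card) :
    Even ((Finset.univ.filter fun k => k < q ∧ b k = true).card +
      (Finset.univ.filter fun k => k < p ∧ Function.update b q false k = true).card) := by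
  rcases lt_or_gt_of_ne hpq with h | h
  · rw [min_eq_left h.le, max_eq_right h.le] at heven
    have key : (Finset.univ.filter fun k => k < p ∧ Function.update b q false k = true) =
        Finset.univ.filter fun k => k < p ∧ b k = true :=
      Finset.filter_congr fun k _ => and_congr_right fun hk => by
        rw [Function.update_of_ne (hk.trans h).ne]
    rw [key, card_occupied_lt_eq_add h hp]
    grind
  · rw [min_eq_right h.le, max_eq_left h.le] at heven
    have below : (Finset.univ.filter fun k => k < q ∧ Function.update b q false k = true) =
        Finset.univ.filter fun k => k < q ∧ b k = true :=
      Finset.filter_congr fun k _ => and_congr_right fun hk => by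
        rw [Function.update_of_ne hk.ne]
    have between :
        (Finset.univ.filter fun k => q < k ∧ k < p ∧ Function.update b q false k = true) =
          Finset.univ.filter fun k => q < k ∧ k < p ∧ b k = true :=
      Finset.filter_congr fun k _ => and_congr_right fun hk => by
        rw [Function.update_of_ne hk.ne']
    rw [card_occupied_lt_eq_add h (Function.update_self q false b), below, between]
    grind

theorem cre_ann_eq_swap_of_even_parity (n : ℕ) (p q : Fin n) (hpq : p ≠ q)
    (b : Fin n → Bool) (hq : b q = true) (hp : b p = false)
    (heven : Even (Finset.univ.filter
        fun k => min p q < k ∧ k < max p q ∧ b k = true).card) :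
    cre n p (ann n q (fket b)) = fket (swapBits b p q) := by
  rw [ann_fket hq, map_smul, cre_fket (by rwa [Function.update_of_ne hpq]), smul_smul, ← pow_add,
    (even_jordanWigner_exponent hpq hp heven).neg_one_pow, one_smul, swapBits, hq, hp,
    Function.update_comm hpq]
end

section
/- Let m N : ℕ and s = 2^m, with registers indexed by Fin 2 × Fin 2 × (Fin m → Fin 2) × Fin N (validation, rotation, selection, Fock) and basis vectors e(u, r, ℓ, j). Let v be a real coefficient function on selection indices with |v ℓ| ≤ 1, let P be a decidable predicate on pairs (ℓ, j), and c : Fin N → (Fin m → Fin 2) → Fin N. Suppose O_𝓗 is a matrix satisfying O_𝓗 *ᵥ e(u, 0, ℓ, j) = (v ℓ : ℂ) • e(u, 0, ℓ, j) + Real.sqrt (1 − (v ℓ)²) • e(u, 1, ℓ, j) for all u, ℓ, j, and O_C is a matrix satisfying, for all r, ℓ, j: O_C *ᵥ e(1, r, ℓ, j) = e(0, r, ℓ, c j ℓ) if P ℓ j, and O_C *ᵥ e(1, r, ℓ, j) = e(1, r, ℓ, j) otherwise. Define U_𝓗 := (I₂ ⊗ I₂ ⊗ D_m ⊗ I_N)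 * O_C * O_𝓗 * (X ⊗ I₂ ⊗ D_m ⊗ I_N) with X := !![0, 1; 1, 0]. Then for all i j : Fin N: ⟨e(0, 0, 0ᵐ, i), U_𝓗 *ᵥ e(0, 0, 0ᵐ, j)⟩ = (1/2^m) · ∑_{ℓ ∈ {ℓ | P ℓ j ∧ c j ℓ = i}} (v ℓ : ℂ); that is, the complete circuit block encodes the matrix with entries (1/s) ∑_{ℓ : P ℓ j, c j ℓ = i} v ℓ. -/
open Matrix Kronecker

/-- The standard basis column vector with a 1 in position `x`. -/
noncomputable def ket {ι : Type*} [DecidableEq ι] (x : ι) : ι → ℂ := Pi.single x 1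

/-- The 2×2 Hadamard matrix `H = (1/√2) !![1, 1; 1, -1]` over `ℂ`. -/
noncomputable def Hmat : Matrix (Fin 2) (Fin 2) ℂ :=
  ((Real.sqrt 2 : ℂ))⁻¹ • !![1, 1; 1, -1]

/-- The `m`-fold Kronecker power of the Hadamard matrix, indexed by bit strings,
with entries `D_m x y = ∏ k, H (x k) (y k)`. -/
noncomputable def Dm (m : ℕ) : Matrix (Fin m → Fin 2) (Fin m → Fin 2) ℂ :=
  fun x y => ∏ k, Hmat (x k) (y k)

theorem Dm_zero_left (m : ℕ) (y : Fin m → Fin 2) :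
    Dm m (fun _ => 0) y = ((Real.sqrt 2 : ℂ))⁻¹ ^ m := by
  have h (b : Fin 2) : Hmat 0 b = ((Real.sqrt 2 : ℂ))⁻¹ := by
    fin_cases b <;> simp [Hmat]
  simp [Dm, h]

theorem Dm_zero_right (m : ℕ) (x : Fin m → Fin 2) :
    Dm m x (fun _ => 0) = ((Real.sqrt 2 : ℂ))⁻¹ ^ m := by
  have h (b : Fin 2) : Hmat b 0 = ((Real.sqrt 2 : ℂ))⁻¹ := by
    fin_cases b <;> simp [Hmat]
  simp [Dm, h]

theorem inv_sqrt_two_pow_mul_self (m : ℕ) :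
    ((Real.sqrt 2 : ℂ))⁻¹ ^ m * ((Real.sqrt 2 : ℂ))⁻¹ ^ m = 1 / 2 ^ m := by
  have h : (Real.sqrt 2 : ℂ) * (Real.sqrt 2 : ℂ) = 2 := by
    rw [← Complex.ofReal_mul, Real.mul_self_sqrt (by norm_num)]
    norm_num
  rw [← mul_pow, ← mul_inv, h, inv_pow, one_div]

/-- Preparing the selection register: `X ⊗ I ⊗ D_m ⊗ I` sends the all-zero selection state
with validation qubit `0` to a uniform superposition with validation qubit `1`. -/
theorem flip_diffusion_mulVec_ket (m N : ℕ) (j : Fin N) :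
    ((!![0, 1; 1, 0] : Matrix (Fin 2) (Fin 2) ℂ) ⊗ₖ ((1 : Matrix (Fin 2) (Fin 2) ℂ) ⊗ₖ
        (Dm m ⊗ₖ (1 : Matrix (Fin N) (Fin N) ℂ)))) *ᵥ
        ket ((0 : Fin 2), (0 : Fin 2), (fun _ => 0 : Fin m → Fin 2), j) =
      ∑ ℓ : Fin m → Fin 2, ((Real.sqrt 2 : ℂ))⁻¹ ^ m • ket ((1 : Fin 2), (0 : Fin 2), ℓ, j) := by
  ext ⟨u, r, ℓ, k⟩
  simp only [ket, mulVec_single_one, col_apply, kroneckerMap_apply, Dm_zero_right,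
    Finset.sum_apply, Pi.smul_apply, Pi.single_apply, Prod.mk.injEq, one_apply, smul_eq_mul]
  rw [Finset.sum_eq_single ℓ (by intro b _ hb; simp [Ne.symm hb]) (by simp)]
  fin_cases u <;> fin_cases r <;> simp

/-- The `(0, 0, 0ᵐ, i)` coordinate after `I ⊗ I ⊗ D_m ⊗ I` averages over the selection register. -/
theorem diffusion_mulVec_apply_zero (m N : ℕ) (i : Fin N)
    (w : Fin 2 × Fin 2 × (Fin m → Fin 2) × Fin N → ℂ) :
    (((1 : Matrix (Fin 2) (Fin 2) ℂ) ⊗ₖ ((1 : Matrix (Fin 2) (Fin 2) ℂ) ⊗ₖ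
        (Dm m ⊗ₖ (1 : Matrix (Fin N) (Fin N) ℂ)))) *ᵥ w)
        ((0 : Fin 2), (0 : Fin 2), (fun _ => 0 : Fin m → Fin 2), i) =
      ((Real.sqrt 2 : ℂ))⁻¹ ^ m * ∑ ℓ : Fin m → Fin 2, w ((0 : Fin 2), (0 : Fin 2), ℓ, i) := by
  simp [mulVec, dotProduct, Fintype.sum_prod_type, kroneckerMap_apply, Dm_zero_left, one_apply,
    Finset.mul_sum]

theorem complete_circuit_block_encoding (m N : ℕ)
    (v : (Fin m → Fin 2) → ℝ) (hv : ∀ ℓ, |v ℓ| ≤ 1)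
    (P : (Fin m → Fin 2) → Fin N → Prop) [∀ ℓ j, Decidable (P ℓ j)]
    (c : Fin N → (Fin m → Fin 2) → Fin N)
    (OH : Matrix (Fin 2 × Fin 2 × (Fin m → Fin 2) × Fin N)
      (Fin 2 × Fin 2 × (Fin m → Fin 2) × Fin N) ℂ)
    (hOH : ∀ (u : Fin 2) (ℓ : Fin m → Fin 2) (j : Fin N),
      OH *ᵥ ket (u, (0 : Fin 2), ℓ, j) =
        (v ℓ : ℂ) • ket (u, (0 : Fin 2), ℓ, j) +
          (Real.sqrt (1 - (v ℓ) ^ 2) : ℂ) • ket (u, (1 : Fin 2), ℓ, j))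
    (OC : Matrix (Fin 2 × Fin 2 × (Fin m → Fin 2) × Fin N)
      (Fin 2 × Fin 2 × (Fin m → Fin 2) × Fin N) ℂ)
    (hOC : ∀ (r : Fin 2) (ℓ : Fin m → Fin 2) (j : Fin N),
      (P ℓ j → OC *ᵥ ket ((1 : Fin 2), r, ℓ, j) = ket ((0 : Fin 2), r, ℓ, c j ℓ)) ∧
      (¬ P ℓ j → OC *ᵥ ket ((1 : Fin 2), r, ℓ, j) = ket ((1 : Fin 2), r, ℓ, j)))
    (UH : Matrix (Fin 2 × Fin 2 × (Fin m → Fin 2) × Fin N)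
      (Fin 2 × Fin 2 × (Fin m → Fin 2) × Fin N) ℂ)
    (hUH : UH =
      ((1 : Matrix (Fin 2) (Fin 2) ℂ) ⊗ₖ ((1 : Matrix (Fin 2) (Fin 2) ℂ) ⊗ₖ
        (Dm m ⊗ₖ (1 : Matrix (Fin N) (Fin N) ℂ)))) * OC * OH *
      ((!![0, 1; 1, 0] : Matrix (Fin 2) (Fin 2) ℂ) ⊗ₖ ((1 : Matrix (Fin 2) (Fin 2) ℂ) ⊗ₖ
        (Dm m ⊗ₖ (1 : Matrix (Fin N) (Fin N) ℂ))))) :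
    ∀ i j : Fin N,
      star (ket ((0 : Fin 2), (0 : Fin 2), (fun _ => 0 : Fin m → Fin 2), i)) ⬝ᵥ
        (UH *ᵥ ket ((0 : Fin 2), (0 : Fin 2), (fun _ => 0 : Fin m → Fin 2), j)) =
      (1 / 2 ^ m : ℂ) *
        ∑ ℓ ∈ Finset.univ.filter (fun ℓ : Fin m → Fin 2 => P ℓ j ∧ c j ℓ = i),
          (v ℓ : ℂ) := by
  intro i j
  have hstar (w : Fin 2 × Fin 2 × (Fin m → Fin 2) × Fin N → ℂ)
      (x : Fin 2 × Fin 2 × (Fin m → Fin 2) × Fin N) : star (ket x) ⬝ᵥ w = w x := by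
    simp [ket]
  have hcoord (ℓ ℓ' : Fin m → Fin 2) :
      (OC *ᵥ (OH *ᵥ ket ((1 : Fin 2), (0 : Fin 2), ℓ, j))) ((0 : Fin 2), (0 : Fin 2), ℓ', i) =
        if ℓ' = ℓ then (if P ℓ j ∧ c j ℓ = i then (v ℓ : ℂ) else 0) else 0 := by
    rw [hOH, mulVec_add, mulVec_smul, mulVec_smul]
    by_cases hP : P ℓ j
    · rw [(hOC 0 ℓ j).1 hP, (hOC 1 ℓ j).1 hP]
      by_cases h : ℓ' = ℓ <;> simp [ket, Pi.single_apply, hP, h, @eq_comm _ i]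
    · rw [(hOC 0 ℓ j).2 hP, (hOC 1 ℓ j).2 hP]
      simp [ket, hP]
  rw [hstar, hUH, ← mulVec_mulVec, flip_diffusion_mulVec_ket, ← mulVec_mulVec, ← mulVec_mulVec,
    diffusion_mulVec_apply_zero]
  simp only [mulVec_sum, mulVec_smul, Finset.sum_apply, Pi.smul_apply, hcoord, smul_eq_mul]
  rw [← inv_sqrt_two_pow_mul_self, mul_assoc, Finset.sum_filter]
  simp [Finset.mul_sum]
end
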